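/- Let F be a finite field, let 1 ≤ m < n, and let A be an n×n Cauchy matrix over F (A i j = (x i − y j)⁻¹ with x, y : Fin n → F injective and x i ≠ y j for all i, j). Let W be a random variable with values in F^{n−m} and Y a random variable uniform on F^m and independent of W, on a finite probability space, and define the shares S = A · (W, Y) ∈ F^n (concatenating W and Y into a column vector). Then: (a) W is a function of S, i.e., H(W | S) = 0; and (b) for every subset B ⊆ [n] with |B| ≤ m, the sub-collection of shares S_B = (S_i)_{i∈B} satisfies I(W; S_B) = 0. Hence S is an (m, n) non-perfect secret sharing of W. -/

import Mathlib

open Finset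

/-- Probability that the finitely-valued random variable `X` takes the value `a`,
on the finite probability space with mass function `μ`. -/
noncomputable def probOf {Ω α : Type} [Fintype Ω] [DecidableEq α]
    (μ : Ω → ℝ) (X : Ω → α) (a : α) : ℝ :=
  ∑ ω ∈ Finset.univ.filter (fun ω => X ω = a), μ ω

/-- Shannon entropy (in bits) of a finitely-valued random variable. -/
noncomputable def shannonH {Ω α : Type} [Fintype Ω] [Fintype α] [DecidableEq α]
    (μ : Ω → ℝ) (X : Ω → α) : ℝ :=
  (∑ a : α, Real.negMulLog (probOf μ X a)) / Real.log 2

/-- Conditional Shannon entropy `H(X | Y)` (in bits). -/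
noncomputable def condH {Ω α β : Type} [Fintype Ω] [Fintype α] [Fintype β]
    [DecidableEq α] [DecidableEq β] (μ : Ω → ℝ) (X : Ω → α) (Y : Ω → β) : ℝ :=
  shannonH μ (fun ω => (X ω, Y ω)) - shannonH μ Y

/-- Mutual information `I(X ; Y)` (in bits). -/
noncomputable def mutInf {Ω α β : Type} [Fintype Ω] [Fintype α] [Fintype β]
    [DecidableEq α] [DecidableEq β] (μ : Ω → ℝ) (X : Ω → α) (Y : Ω → β) : ℝ :=
  shannonH μ X + shannonH μ Y - shannonH μ (fun ω => (X ω, Y ω))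

section Probability

variable {Ω α β : Type} [Fintype Ω] [DecidableEq α] [DecidableEq β] (μ : Ω → ℝ)

theorem probOf_comp_of_injective (X : Ω → α) {f : α → β} (hf : Function.Injective f) (a : α) :
    probOf μ (fun ω => f (X ω)) (f a) = probOf μ X a := by
  simp only [probOf, hf.eq_iff]

theorem probOf_eq_sum_prodMk [Fintype β] (X : Ω → α) (Z : Ω → β) (a : α) :
    probOf μ X a = ∑ b, probOf μ (fun ω => (X ω, Z ω)) (a, b) := by
  simp only [probOf, Prod.mk.injEq, ← Finset.filter_filter]
  exact (Finset.sum_fiberwise _ Z μ).symm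

theorem probOf_prodMk_swap (X : Ω → α) (Z : Ω → β) (a : α) (b : β) :
    probOf μ (fun ω => (Z ω, X ω)) (b, a) = probOf μ (fun ω => (X ω, Z ω)) (a, b) := by
  simp only [probOf, Prod.mk.injEq, and_comm]

theorem sum_probOf [Fintype α] (X : Ω → α) : ∑ a, probOf μ X a = ∑ ω, μ ω :=
  Finset.sum_fiberwise _ X μ

variable [Fintype α] [Fintype β]

theorem shannonH_comp_of_injective (X : Ω → α) {f : α → β} (hf : Function.Injective f) :
    shannonH μ (fun ω => f (X ω)) = shannonH μ X := by
  unfold shannonH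
  congr 1
  symm
  apply Finset.sum_of_injOn f hf.injOn (fun _ _ => Finset.mem_coe.2 (Finset.mem_univ _))
  · intro b _ hb
    have : probOf μ (fun ω => f (X ω)) b = 0 := by
      rw [probOf, Finset.filter_eq_empty_iff.2, Finset.sum_empty]
      rintro ω - rfl
      exact hb ⟨X ω, by simp, rfl⟩
    rw [this, Real.negMulLog_zero]
  · intro a _
    rw [probOf_comp_of_injective μ X hf]

theorem condH_eq_zero_of_eq_comp {X : Ω → α} {Z : Ω → β} (g : β → α)
    (h : ∀ ω, X ω = g (Z ω)) : condH μ X Z = 0 := by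
  have hf : Function.Injective fun b => (g b, b) := fun _ _ hb => (Prod.mk.inj hb).2
  simp only [condH, h, shannonH_comp_of_injective μ Z hf, sub_self]

theorem mutInf_eq_zero_of_indep (hμ : ∑ ω, μ ω = 1) {X : Ω → α} {Z : Ω → β}
    (h : ∀ a b, probOf μ (fun ω => (X ω, Z ω)) (a, b) = probOf μ X a * probOf μ Z b) :
    mutInf μ X Z = 0 := by
  simp only [mutInf, shannonH, Fintype.sum_prod_type, h, Real.negMulLog_mul,
    Finset.sum_add_distrib, ← Finset.sum_mul, ← Finset.mul_sum, sum_probOf, hμ]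
  ring

theorem mutInf_eq_zero_of_probOf_prodMk_eq_mul (hμ : ∑ ω, μ ω = 1) {X : Ω → α} {Z : Ω → β}
    (d : ℝ) (h : ∀ a b, probOf μ (fun ω => (X ω, Z ω)) (a, b) = probOf μ X a * d) :
    mutInf μ X Z = 0 := by
  refine mutInf_eq_zero_of_indep μ hμ fun a b => ?_
  have hb : probOf μ Z b = d := by
    simp only [probOf_eq_sum_prodMk μ Z X, probOf_prodMk_swap, h, ← Finset.sum_mul,
      sum_probOf, hμ, one_mul]
  rw [h, hb]

/-- One-time pad: adding the image of a uniform independent key under a surjective homomorphism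
hides `X`. -/
theorem mutInf_add_map_uniform_eq_zero {G H : Type} [AddGroup G] [Fintype G] [DecidableEq G]
    [AddGroup H] [Fintype H] [DecidableEq H] (hμ : ∑ ω, μ ω = 1) {X : Ω → α} {Y : Ω → G} (c : ℝ)
    (hY : ∀ v, probOf μ Y v = c)
    (hindep : ∀ a v, probOf μ (fun ω => (X ω, Y ω)) (a, v) = probOf μ X a * probOf μ Y v)
    (T : α → H) (φ : G →+ H) (hφ : Function.Surjective φ) :
    mutInf μ X (fun ω => T (X ω) + φ (Y ω)) = 0 := by
  refine mutInf_eq_zero_of_probOf_prodMk_eq_mul μ hμ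
    (#{v : G | φ v = 0} * c) fun a b => ?_
  have hsplit : probOf μ (fun ω => (X ω, T (X ω) + φ (Y ω))) (a, b)
      = ∑ v with φ v = -T a + b, probOf μ (fun ω => (X ω, Y ω)) (a, v) := by
    rw [probOf_eq_sum_prodMk μ _ Y, Finset.sum_filter]
    refine Finset.sum_congr rfl fun v _ => ?_
    simp only [probOf, Prod.mk.injEq]
    split_ifs with hv
    · refine Finset.sum_congr (Finset.filter_congr fun ω _ => ?_) fun _ _ => rfl
      constructor
      · rintro ⟨⟨h1, -⟩, h2⟩
        exact ⟨h1, h2⟩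
      · rintro ⟨rfl, rfl⟩
        simp [hv]
    · rw [Finset.filter_eq_empty_iff.2, Finset.sum_empty]
      rintro ω - ⟨⟨rfl, rfl⟩, rfl⟩
      simp at hv
  rw [hsplit]
  simp only [hindep, hY, Finset.sum_const, nsmul_eq_mul]
  rw [AddMonoidHom.card_fiber_eq_of_mem_range φ (hφ (-T a + b)) (hφ 0)]
  ring

end Probability

section Cauchy

variable {F I J : Type*} [Field F] [Fintype I] [Fintype J]

open Polynomial in
theorem eq_zero_of_cauchy_sum_eq_zero (hcard : Fintype.card J ≤ Fintype.card I)
    {x : I → F} {y : J → F} (hx : Function.Injective x) (hy : Function.Injective y)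
    (hxy : ∀ i j, x i ≠ y j) {c : J → F} (hc : ∀ i, ∑ j, (x i - y j)⁻¹ * c j = 0) : c = 0 := by
  classical
  let P : F[X] := ∑ j, C (c j) * ∏ k ∈ univ.erase j, (X - C (y k))
  have hP : P = 0 := by
    rcases isEmpty_or_nonempty J with hJ | hJ
    · simp [P]
    refine eq_zero_of_natDegree_lt_card_of_eval_eq_zero P hx (fun i => ?_) ?_
    · have : P.eval (x i) = (∏ k, (x i - y k)) * ∑ j, (x i - y j)⁻¹ * c j := by
        simp only [P, eval_finsetSum, eval_mul, eval_C, eval_prod, eval_sub, eval_X,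
          Finset.mul_sum]
        refine Finset.sum_congr rfl fun j _ => ?_
        rw [← Finset.mul_prod_erase univ _ (Finset.mem_univ j)]
        have := sub_ne_zero.2 (hxy i j)
        field_simp
      rw [this, hc, mul_zero]
    · have hdeg : P.natDegree ≤ Fintype.card J - 1 := by
        refine natDegree_sum_le_of_forall_le _ _ fun j _ => ?_
        refine (natDegree_C_mul_le _ _).trans ?_
        rw [natDegree_finsetProd_X_sub_C_eq_card, Finset.card_erase_of_mem (Finset.mem_univ j),
          Finset.card_univ]
      have := Fintype.card_pos (α := J)
      omega
  funext j
  have hj : P.eval (y j) = c j * ∏ k ∈ univ.erase j, (y j - y k) := by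
    simp only [P, eval_finsetSum, eval_mul, eval_C, eval_prod, eval_sub, eval_X]
    refine Finset.sum_eq_single j (fun i _ hij => ?_) (by simp)
    rw [Finset.prod_eq_zero (Finset.mem_erase.2 ⟨hij.symm, Finset.mem_univ j⟩) (sub_self _),
      mul_zero]
  rw [hP, eval_zero] at hj
  refine (mul_eq_zero.1 hj.symm).resolve_right (Finset.prod_ne_zero_iff.2 fun k hk => ?_)
  exact sub_ne_zero.2 (hy.ne (Finset.ne_of_mem_erase hk).symm)

theorem cauchy_mulVec_injective (hcard : Fintype.card J ≤ Fintype.card I)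
    {x : I → F} {y : J → F} (hx : Function.Injective x) (hy : Function.Injective y)
    (hxy : ∀ i j, x i ≠ y j) :
    Function.Injective (Matrix.of fun i j => (x i - y j)⁻¹ : Matrix I J F).mulVec := by
  intro u v huv
  refine sub_eq_zero.1 (eq_zero_of_cauchy_sum_eq_zero hcard hx hy hxy fun i => ?_)
  have h : ((Matrix.of fun i j => (x i - y j)⁻¹ : Matrix I J F).mulVec (u - v)) i = 0 := by
    rw [Matrix.mulVec_sub, huv, sub_self, Pi.zero_apply]
  exact h

theorem cauchy_mulVec_surjective (hcard : Fintype.card I ≤ Fintype.card J)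
    {x : I → F} {y : J → F} (hx : Function.Injective x) (hy : Function.Injective y)
    (hxy : ∀ i j, x i ≠ y j) :
    Function.Surjective (Matrix.of fun i j => (x i - y j)⁻¹ : Matrix I J F).mulVec := by
  set A : Matrix I J F := Matrix.of fun i j => (x i - y j)⁻¹ with hA
  have hinj : Function.Injective A.vecMul := by
    intro u v huv
    refine sub_eq_zero.1 (eq_zero_of_cauchy_sum_eq_zero (x := fun j => -y j) (y := fun i => -x i)
      hcard (neg_injective.comp hy) (neg_injective.comp hx)
      (fun j i h => hxy i j (neg_injective h).symm) fun j => ?_)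
    have h : A.vecMul (u - v) j = 0 := by
      rw [Matrix.sub_vecMul, show A.vecMul u = A.vecMul v from huv, sub_self, Pi.zero_apply]
    rw [← h]
    simp only [Matrix.vecMul, dotProduct, hA, Matrix.of_apply]
    refine Finset.sum_congr rfl fun i _ => ?_
    rw [mul_comm, neg_sub_neg]
  have hrank := (Matrix.vecMul_injective_iff.1 hinj).rank_matrix
  have htop : LinearMap.range A.mulVecLin = ⊤ :=
    Submodule.eq_top_of_finrank_eq (by
      rw [Module.finrank_fintype_fun_eq_card, ← hrank, Matrix.rank])
  exact LinearMap.range_eq_top.1 htop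

end Cauchy

/-- Cauchy matrices give non-perfect secret sharing: let `A`
be an `n×n` Cauchy matrix over a finite field `F`, let `1 ≤ m < n`, let the key
`Y` be uniform on `F^m` and independent of the secret `W ∈ F^{n−m}`, and let the
shares be `S = A·(W, Y)`.  Then (a) `H(W | S) = 0`, and (b) any at most `m` of
the shares reveal nothing about `W`: `I(W; S_B) = 0` for every `B ⊆ [n]` with
`|B| ≤ m`.  Hence `S` is an `(m, n)` non-perfect secret sharing of `W`. -/
theorem stmt_13 (F : Type) [Field F] [Fintype F] [DecidableEq F]
    (n m : ℕ) (hm1 : 1 ≤ m) (hmn : m < n)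
    (x y : Fin n → F) (hx : Function.Injective x) (hy : Function.Injective y)
    (hxy : ∀ i j, x i ≠ y j)
    {Ω : Type} [Fintype Ω] (μ : Ω → ℝ)
    (hμ0 : ∀ ω, 0 ≤ μ ω) (hμ1 : ∑ ω, μ ω = 1)
    (W : Ω → (Fin (n - m) → F)) (Y : Ω → (Fin m → F))
    (hYunif : ∀ v : Fin m → F, probOf μ Y v = 1 / (Fintype.card F : ℝ) ^ m)
    (hindep : ∀ (w : Fin (n - m) → F) (v : Fin m → F),
      probOf μ (fun ω => (W ω, Y ω)) (w, v) = probOf μ W w * probOf μ Y v)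
    (S : Ω → Fin n → F)
    (hS : ∀ ω, S ω
      = (Matrix.of fun i j => (x i - y j)⁻¹ : Matrix (Fin n) (Fin n) F).mulVec
          (fun i => Fin.append (W ω) (Y ω)
            (Fin.cast (by omega : n = n - m + m) i))) :
    condH μ W S = 0 ∧
      ∀ B : Finset (Fin n), B.card ≤ m →
        mutInf μ W (fun ω => fun i : {i : Fin n // i ∈ B} => S ω i.1) = 0 := by
  have hn : n = n - m + m := by omega
  constructor
  · let f : (Fin (n - m) → F) × (Fin m → F) → Fin n → F := fun p =>
      (Matrix.of fun i j => (x i - y j)⁻¹ : Matrix (Fin n) (Fin n) F).mulVec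
        (fun i => Fin.append p.1 p.2 (Fin.cast hn i))
    have hf : Function.Injective f := by
      intro p q hpq
      have h := cauchy_mulVec_injective le_rfl hx hy hxy hpq
      have h' : Fin.append p.1 p.2 = Fin.append q.1 q.2 :=
        funext fun i => congrFun h (Fin.cast hn.symm i)
      exact (Fin.appendEquiv (n - m) m).injective h'
    refine condH_eq_zero_of_eq_comp μ (fun s => (Function.invFun f s).1) fun ω => ?_
    have hω : S ω = f (W ω, Y ω) := hS ω
    rw [hω, Function.leftInverse_invFun hf]
  · intro B hB
    let a : Fin (n - m) → Fin n := fun j => Fin.cast hn.symm (Fin.castAdd m j)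
    let b : Fin m → Fin n := fun j => Fin.cast hn.symm (Fin.natAdd (n - m) j)
    have hb : Function.Injective b := fun i j h => by simpa [b] using h
    let A₂ : Matrix B (Fin m) F := Matrix.of fun i j => (x i.1 - y (b j))⁻¹
    have hsurj : Function.Surjective A₂.mulVec :=
      cauchy_mulVec_surjective (by simpa using hB) (hx.comp Subtype.val_injective) (hy.comp hb)
        fun i j => hxy _ _
    have hSB : (fun ω => fun i : {i : Fin n // i ∈ B} => S ω i.1) = fun ω =>
        (fun i : {i : Fin n // i ∈ B} => ∑ j, (x i.1 - y (a j))⁻¹ * W ω j)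
          + A₂.mulVecLin.toAddMonoidHom (Y ω) := by
      funext ω i
      rw [hS, Matrix.mulVec, dotProduct, ← (finCongr hn.symm).sum_comp, Fin.sum_univ_add]
      simp [A₂, a, b, Matrix.mulVec, dotProduct]
    rw [hSB]
    exact mutInf_add_map_uniform_eq_zero μ hμ1 _ hYunif hindep
      (fun w (i : {i : Fin n // i ∈ B}) => ∑ j, (x i.1 - y (a j))⁻¹ * w j) _ hsurj
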